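/- Assume X has a minimal subspace segmentation {X_1, …, X_K} with no pure segment such that no sample lies in S_k ∩ S_ℓ for k ≠ ℓ and {X_1, …, X_K} is intersected nondegenerately. If d_int < d_min, d_0 ≤ d_min, and n_k > d_k + (K−1)d_0 for all k, then J(K, d, d_min) is a singleton whose unique element is the minimal partition J* = {J_1*, …, J_K*}. -/

import Mathlib

open Submodule Module Finset

noncomputable section

variable {m : ℕ} {ι : Type*}

/-- The subspace spanned by the subfamily of `x` indexed by `S`. -/
def spanOf (x : ι → EuclideanSpace ℝ (Fin m)) (S : Finset ι) :
    Submodule ℝ (EuclideanSpace ℝ (Fin m)) :=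
  Submodule.span ℝ (x '' (S : Set ι))

/-- The rank `r(X_S)` of the subfamily of `x` indexed by `S`. -/
def rOf (x : ι → EuclideanSpace ℝ (Fin m)) (S : Finset ι) : ℕ :=
  Module.finrank ℝ (spanOf x S)

/-- `X_S` is nondegenerate: every subfamily `X_T`, `T ⊆ S`, has rank `min |T| r(X_S)`. -/
def Nondeg (x : ι → EuclideanSpace ℝ (Fin m)) (S : Finset ι) : Prop :=
  ∀ T ⊆ S, rOf x T = min T.card (rOf x S)

/-- `span(X_S)` is a minimal sample subspace: `n(X_S) > r(X_S)` and `X_S` is nondegenerate. -/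
def IsMinimalSeg (x : ι → EuclideanSpace ℝ (Fin m)) (S : Finset ι) : Prop :=
  rOf x S < S.card ∧ Nondeg x S

/-- The component of `x i` in the orthogonal complement of `W ⊓ S'` within `W`. -/
def zComp (x : ι → EuclideanSpace ℝ (Fin m))
    (W S' : Submodule ℝ (EuclideanSpace ℝ (Fin m))) (i : ι) :
    EuclideanSpace ℝ (Fin m) :=
  (orthogonalProjection (W ⊓ (W ⊓ S')ᗮ) (x i) : EuclideanSpace ℝ (Fin m))

/-- The segmentation `{X_1, …, X_K}` is intersected nondegenerately: for every `k` and every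
subfamily indexed by `S` disjoint from `P k`, the family of components of the vectors of `X_k`
in the orthogonal complement (within `span(X_k)`) of `span(X_k) ⊓ span(X_S)` is zero or
nondegenerate. -/
def IntNondeg (x : ι → EuclideanSpace ℝ (Fin m)) {K : ℕ}
    (P : Fin K → Finset ι) : Prop :=
  ∀ (k : Fin K) (S : Finset ι), Disjoint S (P k) →
    (∀ i ∈ P k, zComp x (spanOf x (P k)) (spanOf x S) i = 0) ∨
      Nondeg (zComp x (spanOf x (P k)) (spanOf x S)) (P k)

/-- A minimal subspace segmentation of `X` with no pure segment, with index pieces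
`P 1, …, P K`. -/
structure IsMSSnp (x : ι → EuclideanSpace ℝ (Fin m)) {K : ℕ}
    (P : Fin K → Finset ι) : Prop where
  cover : ∀ i : ι, ∃ k, i ∈ P k
  disj : ∀ k ℓ, k ≠ ℓ → Disjoint (P k) (P ℓ)
  minimal : ∀ k, IsMinimalSeg x (P k)
  distinct : ∀ k ℓ, k ≠ ℓ → spanOf x (P k) ≠ spanOf x (P ℓ)

/-- The non-intersection condition for the minimal segments. -/
def NonIntersect (x : ι → EuclideanSpace ℝ (Fin m)) {K : ℕ}
    (P : Fin K → Finset ι) : Prop :=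
  ∀ (j : ι) (k ℓ : Fin K), k ≠ ℓ → x j ∉ spanOf x (P k) ⊓ spanOf x (P ℓ)

/-- The set `𝒥(K, d, dmin)`: partitions of the index set into `K` pieces, each of size
greater than `dmin`, whose segment ranks sum to at most `d`. -/
def InJSet (x : ι → EuclideanSpace ℝ (Fin m)) (K d dmin : ℕ)
    (Q : Fin K → Finset ι) : Prop :=
  (∀ i : ι, ∃ k, i ∈ Q k) ∧ (∀ k ℓ, k ≠ ℓ → Disjoint (Q k) (Q ℓ)) ∧
    (∀ k, dmin < (Q k).card) ∧ (∑ k, rOf x (Q k)) ≤ d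

lemma mem_spanOf {x : ι → EuclideanSpace ℝ (Fin m)} {S : Finset ι} {i : ι} (hi : i ∈ S) :
    x i ∈ spanOf x S :=
  subset_span ⟨i, hi, rfl⟩

lemma spanOf_le_iff {x : ι → EuclideanSpace ℝ (Fin m)} {S : Finset ι}
    {V : Submodule ℝ (EuclideanSpace ℝ (Fin m))} :
    spanOf x S ≤ V ↔ ∀ i ∈ S, x i ∈ V := by
  simp [spanOf, span_le, Set.subset_def]

lemma spanOf_mono (x : ι → EuclideanSpace ℝ (Fin m)) {S T : Finset ι} (h : S ⊆ T) :
    spanOf x S ≤ spanOf x T :=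
  spanOf_le_iff.2 fun _ hi => mem_spanOf (h hi)

lemma spanOf_union [DecidableEq ι] (x : ι → EuclideanSpace ℝ (Fin m)) (S T : Finset ι) :
    spanOf x (S ∪ T) = spanOf x S ⊔ spanOf x T := by
  simp [spanOf, Set.image_union, span_union]

lemma inf_orthogonal_inf_eq_bot (V W : Submodule ℝ (EuclideanSpace ℝ (Fin m))) :
    (W ⊓ (W ⊓ V)ᗮ) ⊓ V = ⊥ := by
  rw [eq_bot_iff, ← Submodule.inf_orthogonal_eq_bot (W ⊓ V)]
  exact fun v hv => ⟨⟨hv.1.1, hv.2⟩, hv.1.2⟩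

lemma zComp_mem (x : ι → EuclideanSpace ℝ (Fin m))
    (W V : Submodule ℝ (EuclideanSpace ℝ (Fin m))) (i : ι) :
    zComp x W V i ∈ W ⊓ (W ⊓ V)ᗮ :=
  SetLike.coe_mem _

lemma sub_zComp_mem {x : ι → EuclideanSpace ℝ (Fin m)}
    {W V : Submodule ℝ (EuclideanSpace ℝ (Fin m))} {i : ι} (hi : x i ∈ W) :
    x i - zComp x W V i ∈ W ⊓ V := by
  have hW : x i - zComp x W V i ∈ W := W.sub_mem hi (zComp_mem x W V i).1
  obtain ⟨a, ha, b, hb, hab⟩ := mem_sup.1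
    ((Submodule.sup_orthogonal_inf_of_hasOrthogonalProjection
      (inf_le_left : W ⊓ V ≤ W)).ge hW)
  have hbC : b ∈ W ⊓ (W ⊓ V)ᗮ := ⟨hb.2, hb.1⟩
  have hz : inner ℝ b (x i - zComp x W V i) = 0 :=
    (mem_orthogonal _ _).1 (Submodule.sub_starProjection_mem_orthogonal (x i)) b hbC
  have hba : inner ℝ b a = 0 := (mem_orthogonal' _ _).1 hb.1 a ha
  rw [← hab, inner_add_right, hba, zero_add, inner_self_eq_zero] at hz
  rwa [← hab, hz, add_zero]

/-- The components of a spanning family of `W` span the complement of `W ⊓ V` in `W`. -/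
lemma spanOf_zComp (x : ι → EuclideanSpace ℝ (Fin m)) (S : Finset ι)
    (V : Submodule ℝ (EuclideanSpace ℝ (Fin m))) :
    spanOf (zComp x (spanOf x S) V) S = spanOf x S ⊓ (spanOf x S ⊓ V)ᗮ := by
  set W := spanOf x S
  refine le_antisymm (spanOf_le_iff.2 fun i _ => zComp_mem x W V i) fun v hv => ?_
  have hle : W ≤ spanOf (zComp x W V) S ⊔ (W ⊓ V) := by
    refine spanOf_le_iff.2 fun i hi => ?_
    rw [← add_sub_cancel (zComp x W V i) (x i)]
    exact add_mem (mem_sup_left (mem_spanOf hi)) (mem_sup_right (sub_zComp_mem (mem_spanOf hi)))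
  obtain ⟨a, ha, b, hb, rfl⟩ := mem_sup.1 (hle hv.1)
  have haC : a ∈ W ⊓ (W ⊓ V)ᗮ := spanOf_le_iff.2 (fun i _ => zComp_mem x W V i) ha
  have hbC : b ∈ (W ⊓ (W ⊓ V)ᗮ) ⊓ V := ⟨by simpa using sub_mem hv haC, hb.2⟩
  rw [inf_orthogonal_inf_eq_bot, mem_bot] at hbC
  simpa [hbC] using ha

lemma rOf_zComp_add_le [DecidableEq ι] {x : ι → EuclideanSpace ℝ (Fin m)}
    {W : Submodule ℝ (EuclideanSpace ℝ (Fin m))} {S T : Finset ι} (hT : ∀ i ∈ T, x i ∈ W) :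
    rOf (zComp x W (spanOf x S)) T + rOf x S ≤ rOf x (T ∪ S) := by
  have hdis : spanOf (zComp x W (spanOf x S)) T ⊓ spanOf x S = ⊥ :=
    eq_bot_iff.2 ((inf_le_inf_right _ (spanOf_le_iff.2 fun i _ => zComp_mem x W _ i)).trans
      (inf_orthogonal_inf_eq_bot _ W).le)
  have h := finrank_sup_add_finrank_inf_eq (spanOf (zComp x W (spanOf x S)) T) (spanOf x S)
  rw [hdis, finrank_bot, add_zero] at h
  rw [rOf, rOf, rOf, ← h, spanOf_union]
  refine finrank_mono (sup_le (spanOf_le_iff.2 fun i hi => ?_) le_sup_right)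
  rw [← sub_sub_cancel (x i) (zComp x W (spanOf x S) i)]
  exact sub_mem (mem_sup_left (mem_spanOf hi)) (mem_sup_right (sub_zComp_mem (hT i hi)).2)

/-- Adding samples of one segment to samples outside it either raises the rank by the number of
added samples, or makes the span contain the whole segment subspace. -/
lemma IntNondeg.rank_union [DecidableEq ι] {x : ι → EuclideanSpace ℝ (Fin m)} {K : ℕ}
    {P : Fin K → Finset ι} (hnd : IntNondeg x P) {k : Fin K} {S T : Finset ι}
    (hS : Disjoint S (P k)) (hT : T ⊆ P k) :
    T.card + rOf x S ≤ rOf x (T ∪ S) ∨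
      (spanOf x (P k) ≤ spanOf x (T ∪ S) ∧
        rOf x (P k) + rOf x S ≤
          rOf x (T ∪ S) + finrank ℝ ↥(spanOf x (P k) ⊓ spanOf x S)) := by
  set W := spanOf x (P k)
  set V := spanOf x S
  have hTW : ∀ i ∈ T, x i ∈ W := fun i hi => mem_spanOf (hT hi)
  have hadd : rOf (zComp x W V) T + rOf x S ≤ rOf x (T ∪ S) := rOf_zComp_add_le hTW
  have hC : spanOf (zComp x W V) (P k) = W ⊓ (W ⊓ V)ᗮ := spanOf_zComp x (P k) V
  have hdich : rOf (zComp x W V) T = T.card ∨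
      rOf (zComp x W V) (P k) ≤ rOf (zComp x W V) T := by
    rcases hnd k S hS with h0 | h
    · right
      have hbot : spanOf (zComp x W V) (P k) = ⊥ :=
        eq_bot_iff.2 (spanOf_le_iff.2 fun i hi => by rw [mem_bot]; exact h0 i hi)
      rw [rOf, hbot, finrank_bot]
      exact Nat.zero_le _
    · have hmin : rOf (zComp x W V) T = min T.card (rOf (zComp x W V) (P k)) := h T hT
      omega
  rcases hdich with hfree | hfull
  · left
    omega
  right
  have hTC : spanOf (zComp x W V) T = W ⊓ (W ⊓ V)ᗮ := by
    rw [← hC]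
    exact eq_of_le_of_finrank_le (spanOf_mono _ hT) hfull
  have hdecomp : W ⊓ V ⊔ (W ⊓ V)ᗮ ⊓ W = W :=
    Submodule.sup_orthogonal_inf_of_hasOrthogonalProjection inf_le_left
  have hVle : V ≤ spanOf x (T ∪ S) := spanOf_mono x subset_union_right
  constructor
  · rw [← hdecomp]
    refine sup_le (inf_le_right.trans hVle) ?_
    rw [inf_comm, ← hTC]
    refine spanOf_le_iff.2 fun i hi => ?_
    rw [← sub_sub_cancel (x i) (zComp x W V i)]
    exact sub_mem (mem_spanOf (mem_union_left _ hi)) (hVle (sub_zComp_mem (hTW i hi)).2)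
  · have hsum := finrank_add_inf_finrank_orthogonal (inf_le_left : W ⊓ V ≤ W)
    have hr : rOf (zComp x W V) T = finrank ℝ ↥((W ⊓ V)ᗮ ⊓ W) := by
      rw [rOf, hTC, inf_comm]
    have hk : rOf x (P k) = finrank ℝ W := rfl
    omega

/-- The samples of `Q` split into segments saturated by `Q`, each contributing at least its
dimension minus `d₀` to the rank, and unsaturated ones, whose samples all contribute. -/
lemma IntNondeg.exists_saturated [DecidableEq ι] {x : ι → EuclideanSpace ℝ (Fin m)} {K : ℕ}
    {P : Fin K → Finset ι} (hnd : IntNondeg x P)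
    (hdisj : ∀ k ℓ, k ≠ ℓ → Disjoint (P k) (P ℓ)) {d0 : ℕ}
    (hd0 : ∀ k, finrank ℝ ↥(spanOf x (P k) ⊓ ⨆ (j) (_ : j ≠ k), spanOf x (P j)) ≤ d0)
    (Q : Finset ι) (A : Finset (Fin K)) :
    ∃ F : Finset (Fin K), (∀ k ∈ F, spanOf x (P k) ≤ spanOf x (A.biUnion fun k => Q ∩ P k)) ∧
      ∑ k ∈ A, (if k ∈ F then rOf x (P k) - d0 else (Q ∩ P k).card) ≤
        rOf x (A.biUnion fun k => Q ∩ P k) := by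
  suffices H : ∃ F ⊆ A, (∀ k ∈ F, spanOf x (P k) ≤ spanOf x (A.biUnion fun k => Q ∩ P k)) ∧
      ∑ k ∈ A, (if k ∈ F then rOf x (P k) - d0 else (Q ∩ P k).card) ≤
        rOf x (A.biUnion fun k => Q ∩ P k) by
    obtain ⟨F, -, hF⟩ := H
    exact ⟨F, hF⟩
  induction A using Finset.induction_on with
  | empty => exact ⟨∅, by simp⟩
  | insert k A hkA ih =>
    obtain ⟨F, hFA, hF, hsum⟩ := ih
    have hkF : k ∉ F := fun h => hkA (hFA h)
    have hne : ∀ l ∈ A, l ≠ k := fun l hl h => hkA (h ▸ hl)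
    rw [biUnion_insert]
    set U := A.biUnion fun k => Q ∩ P k
    have hUk : Disjoint U (P k) := (disjoint_biUnion_left _ _ _).2 fun l hl =>
      (hdisj l k (hne l hl)).mono_left inter_subset_right
    have hmono : spanOf x U ≤ spanOf x (Q ∩ P k ∪ U) := spanOf_mono x subset_union_right
    rcases hnd.rank_union hUk (inter_subset_right : Q ∩ P k ⊆ P k) with h | ⟨hle, h⟩
    · refine ⟨F, hFA.trans (subset_insert _ _), fun l hl => (hF l hl).trans hmono, ?_⟩
      rw [sum_insert hkA, if_neg hkF]
      omega
    · refine ⟨insert k F, insert_subset_insert _ hFA, fun l hl => ?_, ?_⟩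
      · rcases mem_insert.1 hl with rfl | hl
        · exact hle
        · exact (hF l hl).trans hmono
      · rw [sum_insert hkA, if_pos (mem_insert_self _ _)]
        have hcongr : ∑ l ∈ A, (if l ∈ insert k F then rOf x (P l) - d0 else (Q ∩ P l).card) =
            ∑ l ∈ A, (if l ∈ F then rOf x (P l) - d0 else (Q ∩ P l).card) :=
          sum_congr rfl fun l hl => by simp [hne l hl]
        have hUle : spanOf x U ≤ ⨆ (j) (_ : j ≠ k), spanOf x (P j) := by
          refine spanOf_le_iff.2 fun i hi => ?_
          obtain ⟨l, hl, hil⟩ := mem_biUnion.1 hi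
          exact le_iSup₂_of_le (f := fun j (_ : j ≠ k) => spanOf x (P j)) l (hne l hl) le_rfl
            (mem_spanOf (mem_inter.1 hil).2)
        have hcap := (finrank_mono (inf_le_inf_left (spanOf x (P k)) hUle)).trans (hd0 k)
        have hrmono : rOf x U ≤ rOf x (Q ∩ P k ∪ U) := finrank_mono hmono
        omega

/-- Enlarging a sum of subspaces raises its dimension by at least the sum of the excesses of the
new dimensions over a bound `d₀` for the intersection with the sum of the others. -/
lemma finrank_sup_add_sum_le {κ E : Type*} [DecidableEq κ] [AddCommGroup E] [Module ℝ E]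
    [FiniteDimensional ℝ E] (S : κ → Submodule ℝ E) {d0 : ℕ}
    (hd0 : ∀ k, finrank ℝ ↥(S k ⊓ ⨆ (j) (_ : j ≠ k), S j) ≤ d0)
    (A B : Finset κ) (hAB : Disjoint A B) :
    finrank ℝ ↥(A.sup S) + ∑ k ∈ B, (finrank ℝ (S k) - d0) ≤ finrank ℝ ↥((A ∪ B).sup S) := by
  induction B using Finset.induction_on with
  | empty => rw [union_empty, sum_empty, add_zero]
  | insert k B hkB ih =>
    obtain ⟨hkA, hAB⟩ := disjoint_insert_right.1 hAB
    have hk : k ∉ A ∪ B := by simp [hkA, hkB]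
    have hle : (A ∪ B).sup S ≤ ⨆ (j) (_ : j ≠ k), S j := Finset.sup_le fun j hj =>
      le_iSup₂_of_le (f := fun j (_ : j ≠ k) => S j) j (fun h => hk (h ▸ hj)) le_rfl
    have hcap := (finrank_mono (inf_le_inf_left (S k) hle)).trans (hd0 k)
    have h := finrank_sup_add_finrank_inf_eq (S k) ((A ∪ B).sup S)
    have hmono := finrank_mono (le_sup_right : (A ∪ B).sup S ≤ S k ⊔ (A ∪ B).sup S)
    have := ih hAB
    rw [union_insert, sup_insert, sum_insert hkB]
    omega

lemma add_sum_le_finrank_of_mem {κ E : Type*} [DecidableEq κ] [AddCommGroup E] [Module ℝ E]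
    [FiniteDimensional ℝ E] (S : κ → Submodule ℝ E) {d0 : ℕ}
    (hd0 : ∀ k, finrank ℝ ↥(S k ⊓ ⨆ (j) (_ : j ≠ k), S j) ≤ d0)
    {F : Finset κ} {k : κ} (hk : k ∈ F) (hdk : d0 ≤ finrank ℝ (S k)) {V : Submodule ℝ E}
    (hV : ∀ k ∈ F, S k ≤ V) :
    d0 + ∑ k ∈ F, (finrank ℝ (S k) - d0) ≤ finrank ℝ V := by
  have h := finrank_sup_add_sum_le S hd0 {k} (F.erase k) (by simp)
  rw [singleton_union, insert_erase hk, sup_singleton] at h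
  have hFV := finrank_mono (Finset.sup_le hV)
  have := add_sum_erase F (fun k => finrank ℝ (S k) - d0) hk
  omega

lemma add_sum_lt_finrank_of_mem_of_mem {κ E : Type*} [DecidableEq κ] [AddCommGroup E] [Module ℝ E]
    [FiniteDimensional ℝ E] (S : κ → Submodule ℝ E) {d0 : ℕ}
    (hd0 : ∀ k, finrank ℝ ↥(S k ⊓ ⨆ (j) (_ : j ≠ k), S j) ≤ d0)
    {F : Finset κ} {k l : κ} (hk : k ∈ F) (hl : l ∈ F) (hkl : k ≠ l)
    (hdk : d0 ≤ finrank ℝ (S k)) (hdl : d0 ≤ finrank ℝ (S l))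
    (hint : finrank ℝ ↥(S k ⊓ S l) < d0) {V : Submodule ℝ E} (hV : ∀ k ∈ F, S k ≤ V) :
    d0 + ∑ k ∈ F, (finrank ℝ (S k) - d0) < finrank ℝ V := by
  have hl' : l ∈ F.erase k := mem_erase.2 ⟨hkl.symm, hl⟩
  have h := finrank_sup_add_sum_le S hd0 {k, l} ((F.erase k).erase l) (by simp)
  rw [insert_union, singleton_union, insert_erase hl', insert_erase hk, sup_insert,
    sup_singleton] at h
  have hFV := finrank_mono (Finset.sup_le hV)
  have h2 := finrank_sup_add_finrank_inf_eq (S k) (S l)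
  have hs := add_sum_erase F (fun k => finrank ℝ (S k) - d0) hk
  have hs' := add_sum_erase (F.erase k) (fun k => finrank ℝ (S k) - d0) hl'
  omega

/-- Under the assumptions `d_int < d_min`, `d_0 ≤ d_min` and
`n_k > d_k + (K−1)·d_0`, the set `𝒥(K, d, dmin)` is a singleton whose unique element is the
minimal partition `J* = {J_1*, …, J_K*}` (up to relabeling of the pieces). -/
theorem jset_singleton [Fintype ι] [DecidableEq ι]
    (x : ι → EuclideanSpace ℝ (Fin m)) {K : ℕ} (P : Fin K → Finset ι)
    (hmss : IsMSSnp x P) (hni : NonIntersect x P) (hnd : IntNondeg x P)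
    (d dmin d0 dint : ℕ)
    (hd : d = ∑ k, rOf x (P k))
    (hdmin : IsLeast (Set.range fun k => rOf x (P k)) dmin)
    (hd0 : IsGreatest (Set.range fun k =>
      Module.finrank ℝ ↥(spanOf x (P k) ⊓ ⨆ (j) (_ : j ≠ k), spanOf x (P j))) d0)
    (hdint : IsGreatest {r | ∃ k ℓ : Fin K, k ≠ ℓ ∧
      r = Module.finrank ℝ ↥(spanOf x (P k) ⊓ spanOf x (P ℓ))} dint)
    (h1 : dint < dmin) (h2 : d0 ≤ dmin)
    (h3 : ∀ k, rOf x (P k) + (K - 1) * d0 < (P k).card) :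
    InJSet x K d dmin P ∧
      ∀ Q : Fin K → Finset ι, InJSet x K d dmin Q →
        ∃ e : Fin K ≃ Fin K, ∀ k, Q (e k) = P k := by
  have hge : ∀ k, dmin ≤ rOf x (P k) := fun k => hdmin.2 ⟨k, rfl⟩
  have hcap : ∀ k, finrank ℝ ↥(spanOf x (P k) ⊓ ⨆ (j) (_ : j ≠ k), spanOf x (P j)) ≤ d0 :=
    fun k => hd0.2 ⟨k, rfl⟩
  have hpair : ∀ k l, k ≠ l → finrank ℝ ↥(spanOf x (P k) ⊓ spanOf x (P l)) ≤ dint :=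
    fun k l hkl => hdint.2 ⟨k, l, hkl, rfl⟩
  have hd0le : ∀ k, d0 ≤ rOf x (P k) := fun k => h2.trans (hge k)
  refine ⟨⟨hmss.cover, hmss.disj, fun k => (hge k).trans_lt (hmss.minimal k).1, hd.ge⟩, ?_⟩
  rintro Q ⟨hQcover, hQdisj, hQcard, hQrank⟩
  have hQunion : ∀ j, (univ.biUnion fun k => Q j ∩ P k) = Q j := fun j => by
    ext i
    simpa using fun _ => hmss.cover i
  have hPunion : ∀ k, (univ.biUnion fun j => Q j ∩ P k) = P k := fun k => by
    ext i
    simpa using fun _ => hQcover i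
  have hQsum : ∀ j, ∑ k, (Q j ∩ P k).card = (Q j).card := fun j => by
    conv_rhs => rw [← hQunion j]
    exact (card_biUnion fun k _ l _ hkl =>
      (hmss.disj k l hkl).mono inter_subset_right inter_subset_right).symm
  have hPsum : ∀ k, ∑ j, (Q j ∩ P k).card = (P k).card := fun k => by
    conv_rhs => rw [← hPunion k]
    exact (card_biUnion fun i _ j _ hij =>
      (hQdisj i j hij).mono inter_subset_left inter_subset_left).symm
  have hF : ∀ j, ∃ F : Finset (Fin K), (∀ k ∈ F, spanOf x (P k) ≤ spanOf x (Q j)) ∧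
      ∑ k, (if k ∈ F then rOf x (P k) - d0 else (Q j ∩ P k).card) ≤ rOf x (Q j) := fun j => by
    simpa only [hQunion j] using hnd.exists_saturated hmss.disj hcap (Q j) univ
  choose F hFle hFsum using hF
  have hdsum : d = K * d0 + ∑ k, (rOf x (P k) - d0) := by
    have hK : K * d0 = ∑ _k : Fin K, d0 := by simp
    rw [hd, hK, ← sum_add_distrib]
    exact sum_congr rfl fun k _ => by have := hd0le k; omega
  have hsat : ∀ k, ∃ j, k ∈ F j := by
    by_contra! ⟨k, hk⟩
    have hKd : K * d0 = (K - 1) * d0 + d0 := by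
      obtain ⟨n, rfl⟩ : ∃ n, K = n + 1 := ⟨K - 1, by have := k.2; omega⟩
      simp [add_mul]
    have hcol : ∀ l, rOf x (P l) - d0 ≤
        ∑ j, (if l ∈ F j then rOf x (P l) - d0 else (Q j ∩ P l).card) := fun l => by
      by_cases hl : ∃ j, l ∈ F j
      · obtain ⟨j, hj⟩ := hl
        refine le_trans ?_ (single_le_sum (fun _ _ => Nat.zero_le _) (mem_univ j))
        rw [if_pos hj]
      · push Not at hl
        simp only [hl, if_false, hPsum]
        have := h3 l
        omega
    have hcolk : K * d0 + (rOf x (P k) - d0) <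
        ∑ j, (if k ∈ F j then rOf x (P k) - d0 else (Q j ∩ P k).card) := by
      simp only [hk, if_false, hPsum]
      have := h3 k
      have := hd0le k
      omega
    have htot : ∑ l, ∑ j, (if l ∈ F j then rOf x (P l) - d0 else (Q j ∩ P l).card) ≤ d := by
      rw [sum_comm]
      exact (sum_le_sum fun j _ => hFsum j).trans hQrank
    have hrest := sum_le_sum fun l (_ : l ∈ univ.erase k) => hcol l
    have hs := add_sum_erase univ (fun l => rOf x (P l) - d0) (mem_univ k)
    have hs' := add_sum_erase univ (fun l => ∑ j,
      (if l ∈ F j then rOf x (P l) - d0 else (Q j ∩ P l).card)) (mem_univ k)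
    omega
  have hempty : ∀ j, F j = ∅ → d0 + ∑ k ∈ F j, (rOf x (P k) - d0) < rOf x (Q j) := fun j hj => by
    have h := hFsum j
    simp only [hj, notMem_empty, if_false, hQsum] at h
    have := hQcard j
    rw [hj, sum_empty]
    omega
  have hrow : ∀ j, d0 + ∑ k ∈ F j, (rOf x (P k) - d0) ≤ rOf x (Q j) := fun j => by
    rcases (F j).eq_empty_or_nonempty with hj | ⟨k, hk⟩
    · exact (hempty j hj).le
    · exact add_sum_le_finrank_of_mem (fun k => spanOf x (P k)) hcap hk (hd0le k) (hFle j)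
  have hswap : ∑ j, ∑ k ∈ F j, (rOf x (P k) - d0) =
      ∑ k, (univ.filter fun j => k ∈ F j).card * (rOf x (P k) - d0) := by
    simp only [← sum_const_nat fun _ _ => rfl]
    exact sum_comm' (by simp)
  have hpos : ∀ k, 1 ≤ (univ.filter fun j => k ∈ F j).card := fun k => by
    obtain ⟨j, hj⟩ := hsat k
    exact card_pos.2 ⟨j, by simpa using hj⟩
  have hcolle : ∀ k, rOf x (P k) - d0 ≤
      (univ.filter fun j => k ∈ F j).card * (rOf x (P k) - d0) :=
    fun k => Nat.le_mul_of_pos_left _ (hpos k)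
  have hcolsum := sum_le_sum fun k (_ : k ∈ univ) => hcolle k
  have hrowsum := sum_le_sum fun j (_ : j ∈ univ) => hrow j
  have hsplit : ∑ j, (d0 + ∑ k ∈ F j, (rOf x (P k) - d0)) =
      K * d0 + ∑ j, ∑ k ∈ F j, (rOf x (P k) - d0) := by
    simp [sum_add_distrib]
  have hroweq : ∀ j, d0 + ∑ k ∈ F j, (rOf x (P k) - d0) = rOf x (Q j) := fun j =>
    (sum_eq_sum_iff_of_le fun j _ => hrow j).1 (by omega) j (mem_univ j)
  have hcoleq : ∀ k, rOf x (P k) - d0 =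
      (univ.filter fun j => k ∈ F j).card * (rOf x (P k) - d0) := fun k =>
    (sum_eq_sum_iff_of_le fun k _ => hcolle k).1 (by omega) k (mem_univ k)
  have hne : ∀ j, 1 ≤ (F j).card := fun j =>
    card_pos.2 (nonempty_iff_ne_empty.2 fun hj => (hempty j hj).ne (hroweq j))
  have hone : ∀ j, (F j).card = 1 := by
    rcases h2.lt_or_eq with hlt | heq
    · have hcard : ∀ k, (univ.filter fun j => k ∈ F j).card = 1 := fun k => by
        have := hge k
        exact Nat.eq_of_mul_eq_mul_right (show 0 < rOf x (P k) - d0 by omega)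
          (by rw [one_mul]; exact (hcoleq k).symm)
      have hcount : ∑ j, (F j).card = ∑ k, (univ.filter fun j => k ∈ F j).card := by
        simp only [card_eq_sum_ones]
        exact sum_comm' (by simp)
      refine fun j => ((sum_eq_sum_iff_of_le fun j _ => hne j).1 ?_ j (mem_univ j)).symm
      simp [hcount, hcard]
    · intro j
      refine le_antisymm (not_lt.1 fun hj => ?_) (hne j)
      obtain ⟨k, hk, l, hl, hkl⟩ := one_lt_card.1 hj
      exact (add_sum_lt_finrank_of_mem_of_mem (fun k => spanOf x (P k)) hcap hk hl hkl
        (hd0le k) (hd0le l) ((hpair k l hkl).trans_lt (heq ▸ h1)) (hFle j)).ne (hroweq j)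
  choose f hf using fun j => card_eq_one.1 (hone j)
  have hsurj : Function.Surjective f := fun k => by
    obtain ⟨j, hj⟩ := hsat k
    rw [hf j, mem_singleton] at hj
    exact ⟨j, hj.symm⟩
  have hbij : Function.Bijective f := hsurj.bijective_of_finite
  have hspan : ∀ j, spanOf x (P (f j)) = spanOf x (Q j) := fun j => by
    refine eq_of_le_of_finrank_eq (hFle j (f j) (by simp [hf j])) ?_
    have h := hroweq j
    rw [hf j, sum_singleton] at h
    have := hd0le (f j)
    change rOf x (P (f j)) = rOf x (Q j)
    omega
  have hsub : ∀ j, Q j ⊆ P (f j) := fun j i hi => by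
    obtain ⟨l, hl⟩ := hmss.cover i
    by_cases h : l = f j
    · exact h ▸ hl
    · exact absurd ⟨mem_spanOf hl, hspan j ▸ mem_spanOf hi⟩ (hni i l (f j) h)
  refine ⟨(Equiv.ofBijective f hbij).symm, fun k => ?_⟩
  obtain ⟨j, rfl⟩ := hsurj k
  rw [Equiv.ofBijective_symm_apply_apply]
  refine (hsub j).antisymm fun i hi => ?_
  obtain ⟨j', hj'⟩ := hQcover i
  by_cases h : j' = j
  · exact h ▸ hj'
  · exact absurd hi (disjoint_left.1 (hmss.disj _ _ (hbij.1.ne h)) (hsub j' hj'))
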